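/- Let n ≥ 3, p ∈ (0, n − 2), M > 0 and D > 0. There exists a constant C > 0 depending only on n, p, M, D such that the following holds: for every bounded open convex set Ω ⊂ ℝⁿ with diam(Ω) = D, and every nonzero convex function u continuous on the closure of Ω, twice continuously differentiable in Ω, satisfying det D²u(z) = M·|u(z)|^p for all z ∈ Ω and u = 0 on ∂Ω, one has |u(z)| ≤ C · [dist(z, ∂Ω)]^{2/(n−p)} for all z ∈ Ω. -/

import Mathlib

open Metric MeasureTheory Real

/-- The Hessian matrix of `u : ℝⁿ → ℝ` at `x`, with entries the second partial
derivatives `∂²u/∂xᵢ∂xⱼ` computed via iterated Fréchet derivatives. -/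
noncomputable def hessianMatrix {n : ℕ} (u : EuclideanSpace ℝ (Fin n) → ℝ)
    (x : EuclideanSpace ℝ (Fin n)) : Matrix (Fin n) (Fin n) ℝ :=
  Matrix.of fun i j =>
    fderiv ℝ (fun y => fderiv ℝ u y (EuclideanSpace.single j 1)) x (EuclideanSpace.single i 1)

/-- The determinant of the Hessian matrix, `det D²u(x)`. -/
noncomputable def hessianDet {n : ℕ} (u : EuclideanSpace ℝ (Fin n) → ℝ)
    (x : EuclideanSpace ℝ (Fin n)) : ℝ := (hessianMatrix u x).det

open Filter Topology

/-- If `A ≥ 1` in the Loewner order, then `det A ≥ 1`. -/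
theorem one_le_det_of_sub_one_posSemidef {n : ℕ} {A : Matrix (Fin n) (Fin n) ℝ}
    (h : (A - 1).PosSemidef) : 1 ≤ A.det := by
  have hA : A.IsHermitian := by
    have := h.isHermitian.add (Matrix.isHermitian_one (n := Fin n) (α := ℝ))
    simpa using this
  rw [hA.det_eq_prod_eigenvalues]
  have key : ∀ i, 1 ≤ hA.eigenvalues i := by
    intro i
    have h1 := h.dotProduct_mulVec_nonneg (hA.eigenvectorBasis i)
    rw [Matrix.sub_mulVec, hA.mulVec_eigenvectorBasis, Matrix.one_mulVec] at h1
    have h2 : (star (hA.eigenvectorBasis i).ofLp) ⬝ᵥ (hA.eigenvectorBasis i).ofLp = 1 := by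
      have := hA.eigenvectorBasis.norm_eq_one i
      have h3 := real_inner_self_eq_norm_sq (hA.eigenvectorBasis i)
      rw [this] at h3
      rw [EuclideanSpace.inner_eq_star_dotProduct, dotProduct_comm] at h3
      simpa using h3
    rw [dotProduct_sub, dotProduct_smul, h2] at h1
    simp at h1
    exact h1
  calc (1 : ℝ) = ∏ _i : Fin n, (1 : ℝ) := by simp
    _ ≤ _ := Finset.prod_le_prod (fun _ _ => zero_le_one) (fun i _ => key i)

/-- The determinant is monotone in the Loewner order above positive definite matrices. -/
theorem det_le_det_of_sub_posSemidef {n : ℕ} {A B : Matrix (Fin n) (Fin n) ℝ}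
    (hB : B.PosDef) (h : (A - B).PosSemidef) : B.det ≤ A.det := by
  obtain ⟨S, hS⟩ : ∃ S : Matrix (Fin n) (Fin n) ℝ, B = star S * S := by
    open scoped MatrixOrder in
    exact CStarAlgebra.nonneg_iff_eq_star_mul_self.mp hB.posSemidef.nonneg
  have hdetB : B.det = S.det * S.det := by
    rw [hS, Matrix.det_mul, Matrix.star_eq_conjTranspose, Matrix.det_conjTranspose]; simp
  have hpos := hB.det_pos
  have hS0 : S.det ≠ 0 := by
    intro h0; rw [h0] at hdetB; simp [hdetB] at hpos
  have hST : S * S⁻¹ = 1 := Matrix.mul_nonsing_inv _ hS0.isUnit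
  have hST' : (S⁻¹).conjTranspose * S.conjTranspose = 1 := by
    rw [← Matrix.conjTranspose_mul, hST, Matrix.conjTranspose_one]
  have h1 := h.conjTranspose_mul_mul_same S⁻¹
  have h2 : (S⁻¹).conjTranspose * (A - B) * S⁻¹ = (S⁻¹).conjTranspose * A * S⁻¹ - 1 := by
    rw [Matrix.mul_sub, Matrix.sub_mul]
    congr 1
    rw [hS, Matrix.star_eq_conjTranspose, ← mul_assoc, hST', one_mul, hST]
  rw [h2] at h1
  have h3 := one_le_det_of_sub_one_posSemidef h1
  have h4 : S.det * S⁻¹.det = 1 := by rw [← Matrix.det_mul, hST, Matrix.det_one]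
  rw [Matrix.det_mul, Matrix.det_mul, Matrix.det_conjTranspose, star_trivial] at h3
  have h5 : A.det = B.det * (S⁻¹.det * A.det * S⁻¹.det) := by
    rw [hdetB]; linear_combination (-A.det * (1 + S.det * S⁻¹.det)) * h4
  rw [h5]
  exact le_mul_of_one_le_right hpos.le h3

/-- The second derivative is nonnegative at a local minimum. -/
theorem second_deriv_nonneg_of_isLocalMin {g g' : ℝ → ℝ} {c x : ℝ}
    (hmin : IsLocalMin g x) (h1 : ∀ᶠ r in 𝓝 x, HasDerivAt g (g' r) r)
    (h2 : HasDerivAt g' c x) : 0 ≤ c := by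
  by_contra! hc
  have e : deriv g =ᶠ[𝓝 x] g' := h1.mono fun r hr => hr.deriv
  have hd : deriv (deriv g) x = c := by rw [e.deriv_eq, h2.deriv]
  have hmax := isLocalMax_of_deriv_deriv_neg (by rw [hd]; exact hc) hmin.deriv_eq_zero
    h1.self_of_nhds.continuousAt
  have hconst : g =ᶠ[𝓝 x] fun _ => g x := by
    filter_upwards [hmin, hmax] with y h3 h4 using le_antisymm h4 h3
  have : deriv (deriv g) x = 0 := by
    rw [hconst.deriv.deriv_eq]; simp
  linarith

theorem hessianMatrix_apply {n : ℕ} {u : EuclideanSpace ℝ (Fin n) → ℝ}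
    {z : EuclideanSpace ℝ (Fin n)} (hu : ContDiffAt ℝ 2 u z) (i j : Fin n) :
    hessianMatrix u z i j = fderiv ℝ (fderiv ℝ u) z (EuclideanSpace.single i 1)
      (EuclideanSpace.single j 1) := by
  have hd : DifferentiableAt ℝ (fderiv ℝ u) z :=
    (hu.fderiv_right (m := 1) (by norm_num)).differentiableAt one_ne_zero
  simp only [hessianMatrix, Matrix.of_apply]
  rw [fderiv_clm_apply hd (by fun_prop)]
  simp

theorem isHermitian_hessianMatrix {n : ℕ} {u : EuclideanSpace ℝ (Fin n) → ℝ}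
    {z : EuclideanSpace ℝ (Fin n)} (hu : ContDiffAt ℝ 2 u z) :
    (hessianMatrix u z).IsHermitian := by
  ext i j
  rw [Matrix.conjTranspose_apply, hessianMatrix_apply hu, hessianMatrix_apply hu, star_trivial]
  exact hu.isSymmSndFDerivAt (by simp) _ _

theorem dotProduct_hessianMatrix_mulVec {n : ℕ} {u : EuclideanSpace ℝ (Fin n) → ℝ}
    {z : EuclideanSpace ℝ (Fin n)} (hu : ContDiffAt ℝ 2 u z) (ξ : EuclideanSpace ℝ (Fin n)) :
    ξ.ofLp ⬝ᵥ (hessianMatrix u z).mulVec ξ.ofLp = fderiv ℝ (fderiv ℝ u) z ξ ξ := by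
  have hξ : ξ = ∑ i, ξ i • EuclideanSpace.single i (1 : ℝ) := by
    have := (EuclideanSpace.basisFun (Fin n) ℝ).sum_repr ξ
    simpa using this.symm
  conv_rhs => rw [hξ]
  simp only [dotProduct, Matrix.mulVec, map_sum, map_smul, sum_apply,
    smul_apply, smul_eq_mul, hessianMatrix_apply hu, Finset.mul_sum]
  rw [Finset.sum_comm]
  exact Finset.sum_congr rfl fun _ _ => Finset.sum_congr rfl fun _ _ => by ring

/-- First and second derivatives of a `C²` function along a line. -/
theorem hasDerivAt_comp_line {n : ℕ} {u : EuclideanSpace ℝ (Fin n) → ℝ}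
    {z : EuclideanSpace ℝ (Fin n)} (hu : ContDiffAt ℝ 2 u z) (ξ : EuclideanSpace ℝ (Fin n)) :
    (∀ᶠ r : ℝ in 𝓝 0, HasDerivAt (fun r : ℝ => u (z + r • ξ)) (fderiv ℝ u (z + r • ξ) ξ) r) ∧
    HasDerivAt (fun r : ℝ => fderiv ℝ u (z + r • ξ) ξ) (fderiv ℝ (fderiv ℝ u) z ξ ξ) 0 := by
  have hline : ∀ r : ℝ, HasDerivAt (fun r : ℝ => z + r • ξ) ξ r := fun r => by
    simpa using ((hasDerivAt_id r).smul_const ξ).const_add z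
  have h0 : Tendsto (fun r : ℝ => z + r • ξ) (𝓝 0) (𝓝 z) := by
    simpa using (hline 0).continuousAt.tendsto
  constructor
  · have := h0.eventually (hu.eventually (by simp))
    filter_upwards [this] with r hr
    exact (hr.differentiableAt two_ne_zero).hasFDerivAt.comp_hasDerivAt r (hline r)
  · have hd : DifferentiableAt ℝ (fderiv ℝ u) (z + (0 : ℝ) • ξ) := by
      simpa using (hu.fderiv_right (m := 1) (by norm_num)).differentiableAt one_ne_zero
    have h1 : HasDerivAt (fun r : ℝ => fderiv ℝ u (z + r • ξ))
        (fderiv ℝ (fderiv ℝ u) (z + (0 : ℝ) • ξ) ξ) 0 :=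
      hd.hasFDerivAt.comp_hasDerivAt (0 : ℝ) (hline 0)
    have h2 := h1.clm_apply (hasDerivAt_const (0 : ℝ) ξ)
    simpa using h2

/-- First and second derivatives along a line of the barrier
`x ↦ ℓ(x) ^ α * (C - |x - y|²)`, with `ℓ` affine. -/
theorem hasDerivAt_barrier_line {s α C q m k b : ℝ} (hs : 0 < s) :
    (∀ᶠ r : ℝ in 𝓝 0, HasDerivAt
      (fun r : ℝ => (s + r * b) ^ α * (C - (q + 2 * r * m + r ^ 2 * k)))
      (α * b * (s + r * b) ^ (α - 1) * (C - (q + 2 * r * m + r ^ 2 * k)) -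
        (s + r * b) ^ α * (2 * m + 2 * r * k)) r) ∧
    HasDerivAt (fun r : ℝ => α * b * (s + r * b) ^ (α - 1) * (C - (q + 2 * r * m + r ^ 2 * k)) -
        (s + r * b) ^ α * (2 * m + 2 * r * k))
      (α * (α - 1) * b ^ 2 * s ^ (α - 2) * (C - q) - 4 * α * b * m * s ^ (α - 1)
        - 2 * k * s ^ α) 0 := by
  have hl : ∀ r : ℝ, HasDerivAt (fun r : ℝ => s + r * b) b r := fun r => by
    simpa using ((hasDerivAt_id r).mul_const b).const_add s
  have hq : ∀ r : ℝ, HasDerivAt (fun r : ℝ => C - (q + 2 * r * m + r ^ 2 * k))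
      (-(2 * m + 2 * r * k)) r := fun r => by
    have h1 := ((((hasDerivAt_id r).const_mul 2).mul_const m).const_add q).add
      (((hasDerivAt_id r).pow 2).mul_const k)
    refine (h1.const_sub C).congr_deriv ?_
    simp
  have hm : HasDerivAt (fun r : ℝ => 2 * m + 2 * r * k) (2 * k) 0 := by
    simpa using ((((hasDerivAt_id (0 : ℝ)).const_mul 2).mul_const k).const_add (2 * m))
  constructor
  · have : ∀ᶠ r : ℝ in 𝓝 0, 0 < s + r * b :=
      (hl 0).continuousAt.eventually (lt_mem_nhds (by simpa using hs))
    filter_upwards [this] with r hr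
    refine (((hl r).rpow_const (p := α) (Or.inl hr.ne')).mul (hq r)).congr_deriv ?_
    ring
  · have h0 : s + 0 * b ≠ 0 := by simpa using hs.ne'
    have e1 := ((hl 0).rpow_const (p := α - 1) (Or.inl h0)).const_mul (α * b)
    have e2 := (hl 0).rpow_const (p := α) (Or.inl h0)
    refine ((e1.mul (hq 0)).sub (e2.mul hm)).congr_deriv ?_
    have : α - 1 - 1 = α - 2 := by ring
    simp only [this]
    ring_nf

theorem barrier_second_deriv_le {s α C D q m k b : ℝ} (hs : 0 < s) (hα0 : 0 < α) (hα1 : α < 1)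
    (hq : q ≤ D ^ 2) (hk : 0 ≤ k) (hm : m ^ 2 ≤ D ^ 2 * k)
    (hC : C = D ^ 2 + (1 + 4 * α ^ 2 * D ^ 2) / (α * (1 - α))) :
    α * (α - 1) * b ^ 2 * s ^ (α - 2) * (C - q) - 4 * α * b * m * s ^ (α - 1) - 2 * k * s ^ α
      ≤ -(s ^ α * k + s ^ (α - 2) * b ^ 2) := by
  have e1 : s ^ (α - 1) = s ^ (α - 2) * s := by
    rw [← rpow_add_one hs.ne']; congr 1; ring
  have e2 : s ^ α = s ^ (α - 2) * s ^ 2 := by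
    rw [← rpow_natCast, ← rpow_add hs]; congr 1; push_cast; ring
  rw [e1, e2]
  have ha : 0 < α * (1 - α) := mul_pos hα0 (by linarith)
  have hC1 : 1 + 4 * α ^ 2 * D ^ 2 ≤ α * (1 - α) * (C - q) := by
    have : α * (1 - α) * (C - D ^ 2) = 1 + 4 * α ^ 2 * D ^ 2 := by
      rw [hC, add_sub_cancel_left, mul_div_cancel₀ _ ha.ne']
    nlinarith
  have hP : 0 < s ^ (α - 2) := rpow_pos_of_pos hs _
  have h1 : (1 + 4 * α ^ 2 * D ^ 2) * b ^ 2 ≤ α * (1 - α) * (C - q) * b ^ 2 :=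
    mul_le_mul_of_nonneg_right hC1 (sq_nonneg b)
  have h2 : 0 ≤ 4 * α ^ 2 * D ^ 2 * b ^ 2 + 4 * α * b * m * s + k * s ^ 2 := by
    rcases hk.eq_or_lt with hk0 | hk0
    · have : m = 0 := by
        rw [← hk0] at hm; nlinarith [sq_nonneg m]
      subst this; rw [← hk0]; simp; positivity
    · have h3 : 0 ≤ k * (4 * α ^ 2 * D ^ 2 * b ^ 2 + 4 * α * b * m * s + k * s ^ 2) := by
        have := mul_le_mul_of_nonneg_left hm (show 0 ≤ 4 * α ^ 2 * b ^ 2 by positivity)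
        nlinarith [sq_nonneg (2 * α * b * m + k * s)]
      exact nonneg_of_mul_nonneg_right h3 hk0
  have h3 : 0 ≤ α * (1 - α) * (C - q) * b ^ 2 + 4 * α * b * m * s + 2 * k * s ^ 2
      - (s ^ 2 * k + b ^ 2) := by linarith
  have := mul_nonneg hP.le h3
  linarith

theorem det_smul_one_add_vecMulVec {n : ℕ} {a c : ℝ} (ν : EuclideanSpace ℝ (Fin n))
    (hν : ‖ν‖ = 1) :
    (a • (1 + c • Matrix.vecMulVec ν.ofLp ν.ofLp)).det = a ^ n * (1 + c) := by
  have h : ν.ofLp ⬝ᵥ ν.ofLp = 1 := by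
    have h3 := real_inner_self_eq_norm_sq ν
    rw [hν, EuclideanSpace.inner_eq_star_dotProduct] at h3
    simpa using h3
  rw [Matrix.det_smul, Fintype.card_fin, ← Matrix.smul_vecMulVec, Matrix.vecMulVec_eq Unit,
    Matrix.det_one_add_replicateCol_mul_replicateRow, dotProduct_smul, h]
  simp

/-- A lower bound `D²u ≥ a (I + c ν ⊗ ν)` with `|ν| = 1` gives `det D²u ≥ aⁿ (1 + c)`. -/
theorem le_hessianDet_of_quadraticForm_le {n : ℕ} {u : EuclideanSpace ℝ (Fin n) → ℝ}
    {z ν : EuclideanSpace ℝ (Fin n)} (hu : ContDiffAt ℝ 2 u z) (hν : ‖ν‖ = 1) {a c : ℝ}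
    (ha : 0 < a) (hc : 0 ≤ c)
    (h : ∀ ξ, a * (‖ξ‖ ^ 2 + c * inner ℝ ν ξ ^ 2) ≤ fderiv ℝ (fderiv ℝ u) z ξ ξ) :
    a ^ n * (1 + c) ≤ hessianDet u z := by
  have hP : (Matrix.vecMulVec ν.ofLp ν.ofLp).PosSemidef := by
    simpa using Matrix.posSemidef_vecMulVec_self_star ν.ofLp
  have hB : (a • (1 + c • Matrix.vecMulVec ν.ofLp ν.ofLp)).PosDef :=
    (Matrix.PosDef.one.add_posSemidef (hP.smul hc)).smul ha
  rw [← det_smul_one_add_vecMulVec ν hν]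
  refine det_le_det_of_sub_posSemidef hB (Matrix.PosSemidef.of_dotProduct_mulVec_nonneg
    ((isHermitian_hessianMatrix hu).sub hB.isHermitian) fun x => ?_)
  have h1 := h (WithLp.toLp 2 x)
  rw [← dotProduct_hessianMatrix_mulVec hu] at h1
  have h2 : ‖WithLp.toLp 2 x‖ ^ 2 = x ⬝ᵥ x := by
    rw [← real_inner_self_eq_norm_sq, EuclideanSpace.inner_eq_star_dotProduct]; simp
  have h3 : inner ℝ ν (WithLp.toLp 2 x) = ν.ofLp ⬝ᵥ x := by
    rw [EuclideanSpace.inner_eq_star_dotProduct, dotProduct_comm]; simp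
  rw [h2, h3] at h1
  have h4 : x ⬝ᵥ (a • (1 + c • Matrix.vecMulVec ν.ofLp ν.ofLp)).mulVec x =
      a * (x ⬝ᵥ x + c * (ν.ofLp ⬝ᵥ x) ^ 2) := by
    simp only [Matrix.smul_mulVec, Matrix.add_mulVec, Matrix.one_mulVec, dotProduct_smul,
      dotProduct_add, Matrix.vecMulVec_mulVec, smul_eq_mul,
      op_smul_eq_smul]
    rw [dotProduct_comm x ν.ofLp]; ring
  rw [star_trivial, Matrix.sub_mulVec, dotProduct_sub, h4]
  linarith

/-- A convex function vanishing on the boundary of a bounded open set is nonpositive inside. -/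
theorem ConvexOn.nonpos_of_frontier_eq_zero {n : ℕ} {Ω : Set (EuclideanSpace ℝ (Fin n))}
    {u : EuclideanSpace ℝ (Fin n) → ℝ} (ho : IsOpen Ω) (hb : Bornology.IsBounded Ω)
    (hne : (frontier Ω).Nonempty) (hc : ContinuousOn u (closure Ω)) (hconv : ConvexOn ℝ Ω u)
    (h0 : ∀ z ∈ frontier Ω, u z = 0) {z : EuclideanSpace ℝ (Fin n)} (hz : z ∈ Ω) : u z ≤ 0 := by
  obtain ⟨x, hx, hmax⟩ := hb.isCompact_closure.exists_isMaxOn ⟨z, subset_closure hz⟩ hc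
  refine (hmax (subset_closure hz)).trans ?_
  by_contra! hpos
  have hxΩ : x ∈ Ω := by
    by_contra hx'
    have := h0 x (by rw [ho.frontier_eq]; exact ⟨hx, hx'⟩)
    linarith
  obtain ⟨y, hy⟩ := hne
  have hycl : y ∈ closure Ω := frontier_subset_closure hy
  obtain ⟨w, hw, hwΩ⟩ : ∃ w, u w < u x ∧ w ∈ Ω := by
    have h1 : ∀ᶠ w in 𝓝[Ω] y, u w < u x :=
      ((hc y hycl).mono subset_closure).eventually (gt_mem_nhds (by rw [h0 y hy]; exact hpos))
    have : (𝓝[Ω] y).NeBot := mem_closure_iff_nhdsWithin_neBot.mp hycl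
    exact (h1.and self_mem_nhdsWithin).exists
  have hev : ∀ᶠ δ : ℝ in 𝓝[>] 0, x + δ • (x - w) ∈ Ω := by
    apply Filter.Eventually.filter_mono nhdsWithin_le_nhds
    have : ContinuousAt (fun δ : ℝ => x + δ • (x - w)) 0 := by fun_prop
    exact this.eventually (ho.mem_nhds (by simpa using hxΩ))
  obtain ⟨δ, hδΩ, hδ⟩ := (hev.and self_mem_nhdsWithin).exists
  have hδ : 0 < δ := hδ
  have h1 : 0 < 1 + δ := by linarith
  have h2 := hconv.2 hδΩ hwΩ (show 0 ≤ 1 / (1 + δ) by positivity)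
    (show 0 ≤ δ / (1 + δ) by positivity) (by field_simp)
  have h3 : (1 / (1 + δ)) • (x + δ • (x - w)) + (δ / (1 + δ)) • w = x := by
    rw [div_eq_mul_inv δ, div_eq_mul_inv 1, one_mul]
    have : x = (1 + δ)⁻¹ • ((1 + δ) • x) := by rw [smul_smul, inv_mul_cancel₀ h1.ne', one_smul]
    conv_rhs => rw [this]
    module
  rw [h3, smul_eq_mul, smul_eq_mul] at h2
  have h4 : u (x + δ • (x - w)) ≤ u x := hmax (subset_closure hδΩ)
  have h5 : 1 / (1 + δ) * u (x + δ • (x - w)) ≤ 1 / (1 + δ) * u x :=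
    mul_le_mul_of_nonneg_left h4 (by positivity)
  have h6 : δ / (1 + δ) * u w < δ / (1 + δ) * u x := mul_lt_mul_of_pos_left hw (by positivity)
  have h7 : 1 / (1 + δ) * u x + δ / (1 + δ) * u x = u x := by field_simp
  linarith

theorem exists_unit_supporting_normal {n : ℕ} {Ω : Set (EuclideanSpace ℝ (Fin n))}
    (ho : IsOpen Ω) (hne : Ω.Nonempty) (hconv : Convex ℝ Ω) {y : EuclideanSpace ℝ (Fin n)}
    (hy : y ∉ Ω) : ∃ ν : EuclideanSpace ℝ (Fin n), ‖ν‖ = 1 ∧ ∀ x ∈ Ω, 0 < inner ℝ ν (x - y) := by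
  obtain ⟨f, hf⟩ := geometric_hahn_banach_point_open hconv ho hy
  set w := (InnerProductSpace.toDual ℝ (EuclideanSpace ℝ (Fin n))).symm f with hw
  have hwf : ∀ x, inner ℝ w x = f x := fun x => InnerProductSpace.toDual_symm_apply
  have hw0 : w ≠ 0 := by
    intro h
    obtain ⟨x, hx⟩ := hne
    have := hf x hx
    rw [← hwf, ← hwf, h] at this
    simp at this
  refine ⟨‖w‖⁻¹ • w, norm_smul_inv_norm hw0, fun x hx => ?_⟩
  rw [real_inner_smul_left, hwf, map_sub]
  exact mul_pos (inv_pos.mpr (norm_pos_iff.mpr hw0)) (sub_pos.mpr (hf x hx))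

theorem le_rpow_of_pow_mul_le {n : ℕ} {p M C t s α ψ : ℝ} (hp0 : 0 < p)
    (hpn : p < n) (hM : 0 < M) (hC : 0 < C) (ht : 0 < t) (hs : 0 < s)
    (hα : α * (n - p) = 2) (hψ0 : 0 ≤ ψ) (hψ : ψ ≤ C * s ^ α)
    (h : (t * s ^ α) ^ n * (1 + s ^ (-2 : ℝ)) ≤ M * (t * ψ) ^ p) :
    t ≤ (M * C ^ p) ^ (1 / (n - p)) := by
  have hsα : 0 < s ^ α := rpow_pos_of_pos hs _
  have h1 : M * (t * ψ) ^ p ≤ M * (t * (C * s ^ α)) ^ p := by gcongr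
  have h2 : (t * s ^ α) ^ n * s ^ (-2 : ℝ) ≤ M * (t * (C * s ^ α)) ^ p := by
    refine le_trans ?_ (h.trans h1)
    gcongr
    linarith
  have h3 : t * (C * s ^ α) = C * (t * s ^ α) := by ring
  have hts : 0 < t * s ^ α := by positivity
  rw [h3, mul_rpow hC.le hts.le, ← rpow_natCast] at h2
  have h4 : (t * s ^ α) ^ (n : ℝ) = (t * s ^ α) ^ p * (t * s ^ α) ^ ((n : ℝ) - p) := by
    rw [← rpow_add hts]; congr 1; ring
  have h5 : (t * s ^ α) ^ ((n : ℝ) - p) = t ^ ((n : ℝ) - p) * s ^ (2 : ℝ) := by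
    rw [mul_rpow ht.le hsα.le, ← rpow_mul hs.le, hα]
  have h6 : s ^ (2 : ℝ) * s ^ (-2 : ℝ) = 1 := by rw [← rpow_add hs]; norm_num
  have h7 : (t * s ^ α) ^ p * t ^ ((n : ℝ) - p) ≤ (t * s ^ α) ^ p * (M * C ^ p) := by
    calc _ = (t * s ^ α) ^ p * (t ^ ((n : ℝ) - p) * (s ^ (2 : ℝ) * s ^ (-2 : ℝ))) := by
            rw [h6, mul_one]
      _ = (t * s ^ α) ^ (n : ℝ) * s ^ (-2 : ℝ) := by rw [h4, h5]; ring
      _ ≤ _ := h2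
      _ = _ := by ring
  have h8 := le_of_mul_le_mul_left h7 (rpow_pos_of_pos hts p)
  have hnp : 0 < (n : ℝ) - p := by linarith
  calc t = (t ^ ((n : ℝ) - p)) ^ (1 / ((n : ℝ) - p)) := by
        rw [← rpow_mul ht.le, mul_one_div_cancel hnp.ne', rpow_one]
    _ ≤ _ := by gcongr

/-- Comparison with the barrier `(ε + ⟪ν, x - y⟫) ^ α * (C - |x - y|²)`: at an interior maximum of
the ratio of `-u` to the barrier, the equation bounds that ratio. -/
theorem neg_le_barrier {n : ℕ} {p M D C α ε : ℝ} (hp0 : 0 < p)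
    (hpn : p < n) (hM : 0 < M) (hα : α * (n - p) = 2) (hα0 : 0 < α) (hα1 : α < 1)
    (hC : C = D ^ 2 + (1 + 4 * α ^ 2 * D ^ 2) / (α * (1 - α))) (hε : 0 < ε)
    {Ω : Set (EuclideanSpace ℝ (Fin n))} {u : EuclideanSpace ℝ (Fin n) → ℝ}
    (ho : IsOpen Ω) (hb : Bornology.IsBounded Ω) (hc : ContinuousOn u (closure Ω))
    (hu : ContDiffOn ℝ 2 u Ω) (hdet : ∀ z ∈ Ω, hessianDet u z = M * |u z| ^ p)
    (h0 : ∀ z ∈ frontier Ω, u z = 0) {y ν : EuclideanSpace ℝ (Fin n)} (hν : ‖ν‖ = 1)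
    (hpos : ∀ x ∈ closure Ω, 0 ≤ inner ℝ ν (x - y)) (hdist : ∀ x ∈ closure Ω, ‖x - y‖ ≤ D)
    {z : EuclideanSpace ℝ (Fin n)} (hz : z ∈ Ω) :
    -u z ≤ (M * C ^ p) ^ (1 / (n - p)) * (C * (ε + inner ℝ ν (z - y)) ^ α) := by
  set T := (M * C ^ p) ^ (1 / ((n : ℝ) - p)) with hT
  have hα' : 0 < 1 - α := by linarith
  have hCD : D ^ 2 < C := by
    have : 0 < (1 + 4 * α ^ 2 * D ^ 2) / (α * (1 - α)) := by positivity
    rw [hC]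
    linarith
  have hC0 : 0 < C := (sq_nonneg D).trans_lt hCD
  have hT0 : 0 ≤ T := by positivity
  set σ : EuclideanSpace ℝ (Fin n) → ℝ := fun x => ε + inner ℝ ν (x - y) with hσ
  set ψ : EuclideanSpace ℝ (Fin n) → ℝ := fun x => σ x ^ α * (C - ‖x - y‖ ^ 2) with hψ
  have hσ0 : ∀ x ∈ closure Ω, 0 < σ x := fun x hx => by have := hpos x hx; simp only [hσ]; linarith
  have hq : ∀ x ∈ closure Ω, ‖x - y‖ ^ 2 ≤ D ^ 2 := fun x hx =>
    pow_le_pow_left₀ (norm_nonneg _) (hdist x hx) 2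
  have hψ0 : ∀ x ∈ closure Ω, 0 < ψ x := fun x hx =>
    mul_pos (rpow_pos_of_pos (hσ0 x hx) _) (by linarith [hq x hx])
  have hψC : ∀ x ∈ closure Ω, ψ x ≤ C * σ x ^ α := fun x hx => by
    rw [mul_comm C]
    exact mul_le_mul_of_nonneg_left (by linarith [sq_nonneg ‖x - y‖])
      (rpow_pos_of_pos (hσ0 x hx) _).le
  have hσc : Continuous σ := by fun_prop
  have hψc : ContinuousOn ψ (closure Ω) :=
    (hσc.continuousOn.rpow_const fun x hx => Or.inl (hσ0 x hx).ne').mul (by fun_prop)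
  obtain ⟨x, hx, hmax⟩ := hb.isCompact_closure.exists_isMaxOn ⟨z, subset_closure hz⟩
    (hc.neg.div hψc fun x hx => (hψ0 x hx).ne')
  set t := -u x / ψ x with ht
  have hle : ∀ w ∈ closure Ω, -u w ≤ t * ψ w := fun w hw => by
    rw [← div_le_iff₀ (hψ0 w hw)]
    exact hmax hw
  have hzcl := subset_closure hz
  have hfin : 0 < t → t ≤ T := by
    intro ht0
    have hxΩ : x ∈ Ω := by
      by_contra hx'
      have := h0 x (by rw [ho.frontier_eq]; exact ⟨hx, hx'⟩)
      rw [ht, this] at ht0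
      simp at ht0
    have hux : -u x = t * ψ x := by rw [ht, div_mul_cancel₀ _ (hψ0 x hx).ne']
    have hcd : ContDiffAt ℝ 2 u x := hu.contDiffAt (ho.mem_nhds hxΩ)
    have hs := hσ0 x hx
    have hQ : ∀ ξ, t * σ x ^ α * (‖ξ‖ ^ 2 + σ x ^ (-2 : ℝ) * inner ℝ ν ξ ^ 2) ≤
        fderiv ℝ (fderiv ℝ u) x ξ ξ := by
      intro ξ
      obtain ⟨d1, d2⟩ := hasDerivAt_comp_line hcd ξ
      obtain ⟨d3, d4⟩ := hasDerivAt_barrier_line (α := α) (C := C) (q := ‖x - y‖ ^ 2)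
        (m := inner ℝ (x - y) ξ) (k := ‖ξ‖ ^ 2) (b := inner ℝ ν ξ) hs
      have hline : ∀ r : ℝ, ψ (x + r • ξ) = (σ x + r * inner ℝ ν ξ) ^ α *
          (C - (‖x - y‖ ^ 2 + 2 * r * inner ℝ (x - y) ξ + r ^ 2 * ‖ξ‖ ^ 2)) := by
        intro r
        have e : x + r • ξ - y = (x - y) + r • ξ := by abel
        simp only [hψ, hσ]
        rw [e, norm_add_sq_real, inner_add_right, real_inner_smul_right, real_inner_smul_right,
          norm_smul, mul_pow, Real.norm_eq_abs, sq_abs]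
        ring_nf
      have hmin : IsLocalMin (fun r : ℝ => u (x + r • ξ) + t * ((σ x + r * inner ℝ ν ξ) ^ α *
          (C - (‖x - y‖ ^ 2 + 2 * r * inner ℝ (x - y) ξ + r ^ 2 * ‖ξ‖ ^ 2)))) 0 := by
        have hcont : ContinuousAt (fun r : ℝ => x + r • ξ) 0 := by fun_prop
        have hev := hcont.eventually (ho.mem_nhds (by simpa using hxΩ))
        filter_upwards [hev] with r hr
        rw [← hline, ← hline]
        have := hle _ (subset_closure hr)
        simp only [zero_smul, add_zero]
        linarith
      have hnn := second_deriv_nonneg_of_isLocalMin hmin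
        ((d1.and d3).mono fun r hr => hr.1.add (hr.2.const_mul t)) (d2.add (d4.const_mul t))
      have hcs : inner ℝ (x - y) ξ ^ 2 ≤ D ^ 2 * ‖ξ‖ ^ 2 := by
        rw [← mul_pow, ← sq_abs]
        exact pow_le_pow_left₀ (abs_nonneg _) ((abs_real_inner_le_norm _ _).trans
          (mul_le_mul_of_nonneg_right (hdist x hx) (norm_nonneg _))) 2
      have hbar := mul_le_mul_of_nonneg_left (barrier_second_deriv_le (b := inner ℝ ν ξ) hs hα0 hα1
        (hq x hx) (sq_nonneg ‖ξ‖) hcs hC) ht0.le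
      have e : σ x ^ (α - 2) = σ x ^ α * σ x ^ (-2 : ℝ) := by rw [← rpow_add hs]; rfl
      rw [e] at hbar
      rw [e] at hnn
      linarith
    have hdet' := le_hessianDet_of_quadraticForm_le hcd hν
      (mul_pos ht0 (rpow_pos_of_pos hs α)) (rpow_pos_of_pos hs _).le hQ
    have hψx := hψ0 x hx
    rw [hdet x hxΩ, ← abs_neg, hux, abs_of_pos (mul_pos ht0 hψx)] at hdet'
    exact le_rpow_of_pow_mul_le hp0 hpn hM hC0 ht0 hs hα hψx.le (hψC x hx) hdet'
  have htT : t ≤ T := by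
    rcases le_or_gt t 0 with h | h
    · exact h.trans hT0
    · exact hfin h
  calc -u z ≤ t * ψ z := hle z hzcl
    _ ≤ T * ψ z := mul_le_mul_of_nonneg_right htT (hψ0 z hzcl).le
    _ ≤ T * (C * σ z ^ α) := mul_le_mul_of_nonneg_left (hψC z hzcl) hT0

/-- Optimal Hölder-type boundary estimate `|u| ≲ dist^{2/(n-p)}`
for solutions of `det D²u = M|u|^p`, `0 < p < n-2`, `n ≥ 3`. -/
theorem stmt_7 (n : ℕ) (hn : 3 ≤ n) (p M D : ℝ)
    (hp0 : 0 < p) (hpn : p < (n : ℝ) - 2) (hM : 0 < M) (hD : 0 < D) :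
    ∃ C : ℝ, 0 < C ∧
      ∀ (Ω : Set (EuclideanSpace ℝ (Fin n))) (u : EuclideanSpace ℝ (Fin n) → ℝ),
        IsOpen Ω → Bornology.IsBounded Ω → Convex ℝ Ω →
        Metric.diam Ω = D →
        ContinuousOn u (closure Ω) → ContDiffOn ℝ 2 u Ω → ConvexOn ℝ Ω u →
        (∃ x ∈ Ω, u x ≠ 0) →
        (∀ z ∈ Ω, hessianDet u z = M * |u z| ^ p) →
        (∀ z ∈ frontier Ω, u z = 0) →
        ∀ z ∈ Ω, |u z| ≤ C * infDist z (frontier Ω) ^ (2 / ((n : ℝ) - p)) := by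
  have hnp : 0 < (n : ℝ) - p := by linarith
  set α := 2 / ((n : ℝ) - p) with hα
  have hα0 : 0 < α := by positivity
  have hα1 : α < 1 := by rw [hα, div_lt_one hnp]; linarith
  have hαn : α * (n - p) = 2 := by rw [hα]; field_simp
  have hα' : 0 < 1 - α := by linarith
  obtain ⟨C, hC⟩ : ∃ C, C = D ^ 2 + (1 + 4 * α ^ 2 * D ^ 2) / (α * (1 - α)) := ⟨_, rfl⟩
  have hC0 : 0 < C := by rw [hC]; positivity
  refine ⟨(M * C ^ p) ^ (1 / ((n : ℝ) - p)) * C, by positivity, ?_⟩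
  intro Ω u ho hb hconv hdiam hc hu huconv _ hdet h0 z hz
  have hfr : (frontier Ω).Nonempty := by
    rw [Set.nonempty_iff_ne_empty]
    intro hemp
    rcases isClopen_iff.mp (isClopen_iff_frontier_eq_empty.mpr hemp) with h | h
    · simp [h] at hz
    · have : Nonempty (Fin n) := ⟨⟨0, by omega⟩⟩
      rw [h] at hb
      exact NormedSpace.unbounded_univ ℝ (EuclideanSpace ℝ (Fin n)) hb
  obtain ⟨y, hy, hyd⟩ := isClosed_frontier.exists_infDist_eq_dist hfr z
  have hy' := hy
  rw [ho.frontier_eq] at hy'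
  obtain ⟨ν, hν, hνpos⟩ := exists_unit_supporting_normal ho ⟨z, hz⟩ hconv hy'.2
  have hpos : ∀ x ∈ closure Ω, 0 ≤ inner ℝ ν (x - y) := by
    have hcl : IsClosed {x | 0 ≤ inner ℝ ν (x - y)} := isClosed_le (by fun_prop) (by fun_prop)
    exact fun x hx => closure_minimal (fun w hw => (hνpos w hw).le) hcl hx
  have hdist : ∀ x ∈ closure Ω, ‖x - y‖ ≤ D := fun x hx => by
    rw [← dist_eq_norm, ← hdiam, ← Metric.diam_closure]
    exact Metric.dist_le_diam_of_mem hb.closure hx hy'.1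
  rw [abs_of_nonpos (huconv.nonpos_of_frontier_eq_zero ho hb hfr hc h0 hz)]
  have hlim : Tendsto (fun ε : ℝ => (M * C ^ p) ^ (1 / ((n : ℝ) - p)) *
      (C * (ε + inner ℝ ν (z - y)) ^ α)) (𝓝[>] 0) (𝓝 ((M * C ^ p) ^ (1 / ((n : ℝ) - p)) *
      (C * (0 + inner ℝ ν (z - y)) ^ α))) := by
    apply Tendsto.mono_left _ nhdsWithin_le_nhds
    have h1 : ContinuousAt (fun ε : ℝ => (ε + inner ℝ ν (z - y)) ^ α) 0 :=
      ContinuousAt.rpow_const (by fun_prop) (Or.inr hα0.le)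
    exact (h1.const_mul C).const_mul _
  have hmain := ge_of_tendsto hlim (eventually_nhdsWithin_of_forall fun ε hε =>
    neg_le_barrier hp0 (by linarith) hM hαn hα0 hα1 hC hε ho hb hc hu hdet h0 hν hpos hdist hz)
  refine hmain.trans ?_
  rw [zero_add, ← mul_assoc]
  have hin : inner ℝ ν (z - y) ≤ infDist z (frontier Ω) := by
    rw [hyd, dist_eq_norm]
    simpa [hν] using real_inner_le_norm ν (z - y)
  have := (hνpos z hz).le
  gcongr
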